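/- Let b ≥ 0 and c ≥ 0 be integers. Then there exist a function g in PL and a polynomial p with rational coefficients such that for all real x < 1, ∫₀ˣ (1−t)^b (ln(1/(1−t)))^c dt = (1−x)^{b+1}·g(x) + p(x). -/

import Mathlib

/-- The class `PL` of real functions on `(-∞, 1)` of the form
`f(x) = ∑_{i=1}^m aᵢ (1-x)^{bᵢ} (ln(1/(1-x)))^{cᵢ}` with rational
coefficients `aᵢ` and nonnegative integer exponents `bᵢ`, `cᵢ`. -/
def PL (f : ℝ → ℝ) : Prop :=
  ∃ (m : ℕ) (a : Fin m → ℚ) (b c : Fin m → ℕ),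
    ∀ x : ℝ, x < 1 →
      f x = ∑ i, (a i : ℝ) * (1 - x) ^ b i * Real.log (1 / (1 - x)) ^ c i

/-- The operator `q ↦ q' - d q` on rational polynomials hits every monomial when `d ≠ 0`. -/
theorem exists_derivative_sub_C_mul_eq_X_pow {d : ℚ} (hd : d ≠ 0) (c : ℕ) :
    ∃ q : Polynomial ℚ,
      Polynomial.derivative q - Polynomial.C d * q = Polynomial.X ^ c := by
  have hC : Polynomial.C d * Polynomial.C d⁻¹ = (1 : Polynomial ℚ) := by
    rw [← Polynomial.C_mul, mul_inv_cancel₀ hd, Polynomial.C_1]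
  induction c with
  | zero =>
    refine ⟨-Polynomial.C d⁻¹, ?_⟩
    simp only [Polynomial.derivative_neg, Polynomial.derivative_C, pow_zero]
    linear_combination hC
  | succ c ih =>
    obtain ⟨q, hq⟩ := ih
    refine ⟨Polynomial.C d⁻¹ * (((c : Polynomial ℚ) + 1) * q - Polynomial.X ^ (c + 1)), ?_⟩
    simp only [Polynomial.derivative_C, Polynomial.derivative_sub, Polynomial.derivative_mul,
      Polynomial.derivative_natCast, Polynomial.derivative_one,
      Polynomial.derivative_X_pow_succ, map_add, map_one, map_natCast]
    linear_combination Polynomial.C d⁻¹ * ((c : Polynomial ℚ) + 1) * hq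
      + Polynomial.X ^ (c + 1) * hC

theorem PL_aeval_log (q : Polynomial ℚ) :
    PL fun x => Polynomial.aeval (Real.log (1 / (1 - x))) q := by
  refine ⟨q.natDegree + 1, fun i => q.coeff i, fun _ => 0, fun i => i, fun x _ => ?_⟩
  simp only [pow_zero, mul_one]
  rw [Polynomial.aeval_eq_sum_range, ← Fin.sum_univ_eq_sum_range
    (fun i => q.coeff i • Real.log (1 / (1 - x)) ^ i)]
  simp only [Rat.smul_def]

theorem hasDerivAt_log_one_div_one_sub {x : ℝ} (hx : x < 1) :
    HasDerivAt (fun t : ℝ => Real.log (1 / (1 - t))) (1 - x)⁻¹ x := by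
  have h := (((hasDerivAt_id x).const_sub 1).log (sub_pos.2 hx).ne').neg
  simp only [one_div, Real.log_inv]
  refine HasDerivAt.congr_deriv h ?_
  simp [neg_div]

theorem hasDerivAt_one_sub_pow_mul_aeval_log (b : ℕ) (q : Polynomial ℚ) {x : ℝ} (hx : x < 1) :
    HasDerivAt
      (fun t : ℝ => (1 - t) ^ (b + 1) * Polynomial.aeval (Real.log (1 / (1 - t))) q)
      ((1 - x) ^ b * Polynomial.aeval (Real.log (1 / (1 - x)))
        (Polynomial.derivative q - Polynomial.C ((b : ℚ) + 1) * q)) x := by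
  have h0 : (1 - x) ≠ 0 := (sub_pos.2 hx).ne'
  have hq := (q.hasDerivAt_aeval (Real.log (1 / (1 - x)))).comp x
    (hasDerivAt_log_one_div_one_sub hx)
  have h := (((hasDerivAt_id x).const_sub 1).pow (b + 1)).mul hq
  refine HasDerivAt.congr_deriv h ?_
  simp only [map_sub, map_mul, map_add, map_one, map_natCast, Function.comp_apply, id,
    Nat.cast_add, Nat.cast_one, Nat.add_sub_cancel, Pi.pow_apply]
  field_simp
  ring

/-- For all nonnegative integers `b`, `c`, there are `g ∈ PL`
and a polynomial `p` with rational coefficients such that for all real `x < 1`,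
`∫_0^x (1-t)^b (ln(1/(1-t)))^c dt = (1-x)^{b+1}·g(x) + p(x)`. -/
theorem integral_eq_PL_plus_polynomial (b c : ℕ) :
    ∃ g : ℝ → ℝ, PL g ∧ ∃ p : Polynomial ℚ, ∀ x : ℝ, x < 1 →
      (∫ t in (0 : ℝ)..x, (1 - t) ^ b * Real.log (1 / (1 - t)) ^ c)
        = (1 - x) ^ (b + 1) * g x + Polynomial.aeval x p := by
  obtain ⟨q, hq⟩ := exists_derivative_sub_C_mul_eq_X_pow
    (Nat.cast_add_one_ne_zero b : (b : ℚ) + 1 ≠ 0) c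
  refine ⟨_, PL_aeval_log q, Polynomial.C (-q.eval 0), fun x hx => ?_⟩
  have hlt : ∀ t ∈ Set.uIcc 0 x, t < 1 := fun t ht =>
    ht.2.trans_lt (max_lt zero_lt_one hx)
  rw [intervalIntegral.integral_eq_sub_of_hasDerivAt
    (f := fun t : ℝ => (1 - t) ^ (b + 1) * Polynomial.aeval (Real.log (1 / (1 - t))) q)]
  · have h0 : Polynomial.aeval (0 : ℝ) q = ((q.eval 0 : ℚ) : ℝ) := by
      simpa using Polynomial.aeval_algebraMap_apply ℝ (0 : ℚ) q
    simp [h0, sub_eq_add_neg]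
  · intro t ht
    have h := hasDerivAt_one_sub_pow_mul_aeval_log b q (hlt t ht)
    rwa [hq, map_pow, Polynomial.aeval_X] at h
  · refine ContinuousOn.intervalIntegrable fun t ht => ContinuousAt.continuousWithinAt ?_
    exact ((continuous_const.sub continuous_id).pow b).continuousAt.mul
      ((hasDerivAt_log_one_div_one_sub (hlt t ht)).continuousAt.pow c)
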